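/- (Separation of resonances.) For every s = 1,…,d−1 there exist positive constants C̃_s and D̃_s, depending only on 𝔠, 𝔉, d, ε, τ, δ_{s−1}, C_{s−1} and D_{s−1}, such that if C_s > C̃_s and D_s > D̃_s, then the following holds: for every submodule M of ℤ^d of dimension s, every ζ ∈ E⁽ˢ⁾_M, and every k′ ∈ ℤ^d with ‖k′‖ ≤ ⟨ζ_{k′}⟩^ε, one has ζ + k′ ∉ Z⁽ˢ′⁾_{M′} for every submodule M′ of ℤ^d with M′ ⊄ M and dimension s′ satisfying 1 ≤ s′ ≤ s. -/

import Mathlib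

/-- A positive definite symmetric bilinear form on `ℝ^d`. -/
structure PDForm (d : ℕ) where
  B : (Fin d → ℝ) →ₗ[ℝ] (Fin d → ℝ) →ₗ[ℝ] ℝ
  symm : ∀ x y, B x y = B y x
  posdef : ∀ x, x ≠ 0 → 0 < B x x

namespace PDForm

variable {d : ℕ} (g : PDForm d)

/-- The inner product `⟨·,·⟩` associated with the form. -/
def inn (x y : Fin d → ℝ) : ℝ := g.B x y

/-- The norm `‖·‖` associated with the form. -/
noncomputable def nrm (x : Fin d → ℝ) : ℝ := Real.sqrt (g.inn x x)

/-- The Japanese bracket `⟨x⟩ = (1+‖x‖²)^{1/2}`. -/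
noncomputable def jap (x : Fin d → ℝ) : ℝ := Real.sqrt (1 + g.inn x x)

end PDForm

/-- Cast of a lattice vector of `ℤ^d` into `ℝ^d`. -/
def zc {d : ℕ} (k : Fin d → ℤ) : Fin d → ℝ := fun i => (k i : ℝ)

/-- `𝔠 := min{‖k‖² : k ∈ ℤ^d, k ≠ 0}`. -/
noncomputable def frakc {d : ℕ} (g : PDForm d) : ℝ :=
  sInf {x | ∃ k : Fin d → ℤ, k ≠ 0 ∧ x = (g.nrm (zc k)) ^ 2}

/-- Gram volume `√det(⟨u_i,u_j⟩)` of an `s`-tuple of vectors. -/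
noncomputable def gvol {d s : ℕ} (g : PDForm d) (u : Fin s → (Fin d → ℝ)) : ℝ :=
  Real.sqrt (Matrix.det (Matrix.of fun i j => g.inn (u i) (u j)))

/-- `𝔉`, the minimal Gram volume of parallelepipeds with linearly independent integer edges. -/
noncomputable def frakC {d : ℕ} (g : PDForm d) : ℝ :=
  sInf {x | ∃ (s : ℕ) (u : Fin s → (Fin d → ℤ)), 1 ≤ s ∧ s ≤ d ∧
    LinearIndependent ℝ (fun j => zc (u j)) ∧ x = gvol g (fun j => zc (u j))}

/-- A submodule of `ℤ^d` in the sense of the paper: `span_ℝ(M) ∩ ℤ^d = M`. -/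
def IsSat {d : ℕ} (M : Submodule ℤ (Fin d → ℤ)) : Prop :=
  ∀ k : Fin d → ℤ, zc k ∈ Submodule.span ℝ (zc '' (M : Set (Fin d → ℤ))) → k ∈ M

/-- The dimension (rank) of a submodule of `ℤ^d`. -/
noncomputable def zrank {d : ℕ} (M : Submodule ℤ (Fin d → ℤ)) : ℕ := Module.finrank ℤ M

/-- `ξ_k := ξ + κ + k/2`. -/
noncomputable def xik {d : ℕ} (κ : Fin d → ℝ) (ξ k : Fin d → ℤ) : Fin d → ℝ :=
  fun i => (ξ i : ℝ) + κ i + (k i : ℝ) / 2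

/-- All the data entering the definition of the resonant zones. -/
structure ZoneData (d : ℕ) where
  g : PDForm d
  κ : Fin d → ℝ
  E : Set (Fin d → ℤ)
  δ : ℝ
  ε : ℝ
  τ : ℝ
  Cs : ℕ → ℝ
  Ds : ℕ → ℝ

namespace ZoneData

variable {d : ℕ} (Z : ZoneData d)

/-- `δ_s := δ + s (d+τ+1) ε`. -/
noncomputable def δs (s : ℕ) : ℝ := Z.δ + s * ((d + Z.τ + 1) * Z.ε)

/-- The completely nonresonant zone `Z⁽⁰⁾`. -/
noncomputable def Z0 : Set (Fin d → ℤ) :=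
  {ξ | ξ ∈ Z.E ∧ ∀ k : Fin d → ℤ, k ≠ 0 →
    Z.g.nrm (zc k) ≤ (Z.g.jap (xik Z.κ ξ k)) ^ Z.ε →
    |Z.g.inn (xik Z.κ ξ k) (zc k)| >
      (Z.g.jap (xik Z.κ ξ k)) ^ Z.δ * (Z.g.nrm (zc k)) ^ (-Z.τ)}

/-- The resonant zone `Z⁽ˢ⁾_M`, union over linearly independent `s`-tuples in `M`
of the zones `Z_{k₁,…,k_s}`. -/
noncomputable def ZM (s : ℕ) (M : Submodule ℤ (Fin d → ℤ)) : Set (Fin d → ℤ) :=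
  {ξ | ξ ∈ Z.E ∧ ∃ (hs : 0 < s) (k : Fin s → (Fin d → ℤ)),
    (∀ j, k j ∈ M) ∧ LinearIndependent ℝ (fun j => zc (k j)) ∧
    ∀ j : Fin s,
      |Z.g.inn (xik Z.κ ξ (k ⟨0, hs⟩)) (zc (k j))| ≤
        Z.Cs j * (Z.g.jap (xik Z.κ ξ (k ⟨0, hs⟩))) ^ (Z.δs j) * (Z.g.nrm (zc (k j))) ^ (-Z.τ) ∧
      Z.g.nrm (zc (k j)) ≤ Z.Ds j * (Z.g.jap (xik Z.κ ξ (k ⟨0, hs⟩))) ^ Z.ε}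

/-- The resonant block `B⁽ˢ⁾_M`. -/
noncomputable def BM (s : ℕ) (M : Submodule ℤ (Fin d → ℤ)) : Set (Fin d → ℤ) :=
  Z.ZM s M \
    ⋃ (M' : Submodule ℤ (Fin d → ℤ)) (_ : IsSat M' ∧ zrank M' = s + 1), Z.ZM (s + 1) M'

/-- The extended block `E⁽ˢ⁾_M` (for `s ≥ 1`). -/
noncomputable def EM : ℕ → Submodule ℤ (Fin d → ℤ) → Set (Fin d → ℤ)
  | s, M =>
    {ξ | (∃ b ∈ Z.BM s M, ∃ m ∈ M, ξ = b + m) ∧ ξ ∈ Z.ZM s M ∧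
      ∀ r, 1 ≤ r → r < s → ∀ M' : Submodule ℤ (Fin d → ℤ),
        IsSat M' → zrank M' = r → ξ ∉ EM r M'}
  termination_by s => s

end ZoneData

/-- Conditions on the parameters `δ, ε, τ`. -/
def ParamsOK (d : ℕ) (δ ε τ : ℝ) : Prop :=
  1 ≤ d ∧ 0 < δ ∧ δ < 1 ∧ 0 < ε ∧ (d : ℝ) - 1 < τ ∧
    δ + d * ((d + τ + 1) * ε) < 1 ∧ ε * (τ + 1) ≤ δ

/-- Conditions `1 = C₀ < C₁ < ⋯ < C_{d-1}` and `1 = D₀ < D₁ < ⋯ < D_{d-1}`. -/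
def SeqOK (d : ℕ) (Cs Ds : ℕ → ℝ) : Prop :=
  Cs 0 = 1 ∧ Ds 0 = 1 ∧ (∀ j, j + 2 ≤ d → Cs j < Cs (j + 1)) ∧
    (∀ j, j + 2 ≤ d → Ds j < Ds (j + 1))


namespace PDForm

open scoped Matrix

variable {d : ℕ} (g : PDForm d)

lemma inn_self_nonneg (x : Fin d → ℝ) : 0 ≤ g.inn x x := by
  by_cases h : x = 0
  · simp [inn, h]
  · exact (g.posdef x h).le

lemma inn_comm (x y : Fin d → ℝ) : g.inn x y = g.inn y x := g.symm x y

lemma inn_add_left (x y z : Fin d → ℝ) : g.inn (x + y) z = g.inn x z + g.inn y z := by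
  simp [inn]

lemma inn_sub_left (x y z : Fin d → ℝ) : g.inn (x - y) z = g.inn x z - g.inn y z := by
  simp [inn]

lemma inn_sum_smul_left {ι : Type*} [Fintype ι] (c : ι → ℝ) (u : ι → Fin d → ℝ)
    (z : Fin d → ℝ) : g.inn (∑ i, c i • u i) z = ∑ i, c i * g.inn (u i) z := by
  simp [inn, map_sum, LinearMap.sum_apply]

lemma inn_sum_smul_right {ι : Type*} [Fintype ι] (c : ι → ℝ) (u : ι → Fin d → ℝ)
    (z : Fin d → ℝ) : g.inn z (∑ i, c i • u i) = ∑ i, c i * g.inn z (u i) := by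
  simp [inn, map_sum]

lemma nrm_nonneg (x : Fin d → ℝ) : 0 ≤ g.nrm x := Real.sqrt_nonneg _

lemma nrm_sq (x : Fin d → ℝ) : g.nrm x ^ 2 = g.inn x x := Real.sq_sqrt (g.inn_self_nonneg x)

lemma abs_inn_le (x y : Fin d → ℝ) : |g.inn x y| ≤ g.nrm x * g.nrm y := by
  refine abs_le_of_sq_le_sq ?_ (mul_nonneg (g.nrm_nonneg x) (g.nrm_nonneg y))
  rw [mul_pow, nrm_sq, nrm_sq]
  exact LinearMap.BilinForm.apply_sq_le_of_symm g.B g.inn_self_nonneg ⟨g.symm⟩ x y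

lemma nrm_add_le (x y : Fin d → ℝ) : g.nrm (x + y) ≤ g.nrm x + g.nrm y := by
  refine le_of_sq_le_sq ?_ (add_nonneg (g.nrm_nonneg x) (g.nrm_nonneg y))
  have h := (le_abs_self _).trans (g.abs_inn_le x y)
  have e : g.inn (x + y) (x + y) = g.inn x x + 2 * g.inn x y + g.inn y y := by
    have := g.symm x y
    simp only [inn, map_add, LinearMap.add_apply]
    linarith
  rw [nrm_sq, e, ← nrm_sq, ← nrm_sq]
  nlinarith

lemma nrm_smul (c : ℝ) (x : Fin d → ℝ) : g.nrm (c • x) = |c| * g.nrm x := by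
  have : g.inn (c • x) (c • x) = c ^ 2 * g.inn x x := by simp [inn]; ring
  rw [nrm, this, Real.sqrt_mul (sq_nonneg c), Real.sqrt_sq_eq_abs, nrm]

lemma nrm_neg (x : Fin d → ℝ) : g.nrm (-x) = g.nrm x := by simp [nrm, inn]

lemma nrm_sub_le (x y : Fin d → ℝ) : g.nrm (x - y) ≤ g.nrm x + g.nrm y := by
  rw [sub_eq_add_neg, ← g.nrm_neg y]
  exact g.nrm_add_le x (-y)

lemma jap_nonneg (x : Fin d → ℝ) : 0 ≤ g.jap x := Real.sqrt_nonneg _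

lemma jap_sq (x : Fin d → ℝ) : g.jap x ^ 2 = 1 + g.nrm x ^ 2 := by
  rw [nrm_sq, jap, Real.sq_sqrt (by linarith [g.inn_self_nonneg x])]

lemma one_le_jap (x : Fin d → ℝ) : 1 ≤ g.jap x := by
  nlinarith [g.jap_sq x, g.jap_nonneg x, sq_nonneg (g.nrm x)]

lemma nrm_le_jap (x : Fin d → ℝ) : g.nrm x ≤ g.jap x := by
  nlinarith [g.jap_sq x, g.jap_nonneg x, g.nrm_nonneg x]

lemma jap_le_one_add_nrm (x : Fin d → ℝ) : g.jap x ≤ 1 + g.nrm x := by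
  nlinarith [g.jap_sq x, g.jap_nonneg x, g.nrm_nonneg x]

lemma jap_add_le (x y : Fin d → ℝ) : g.jap (x + y) ≤ g.jap x + g.nrm y := by
  have h : g.nrm (x + y) ^ 2 ≤ (g.nrm x + g.nrm y) ^ 2 :=
    pow_le_pow_left₀ (g.nrm_nonneg _) (g.nrm_add_le x y) 2
  refine le_of_sq_le_sq ?_ (add_nonneg (g.jap_nonneg x) (g.nrm_nonneg y))
  nlinarith [g.jap_sq x, g.jap_sq (x + y), g.nrm_le_jap x, g.nrm_nonneg y,
    mul_le_mul_of_nonneg_right (g.nrm_le_jap x) (g.nrm_nonneg y)]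

/-- The Gram matrix of a family of vectors. -/
def gramMatrix {ι : Type*} (u : ι → Fin d → ℝ) : Matrix ι ι ℝ :=
  Matrix.of fun i j => g.inn (u i) (u j)

lemma gramMatrix_posDef {ι : Type*} [Fintype ι] {u : ι → Fin d → ℝ}
    (hu : LinearIndependent ℝ u) : (g.gramMatrix u).PosDef := by
  refine Matrix.PosDef.of_dotProduct_mulVec_pos ?_ fun x hx => ?_
  · ext i j
    simp [gramMatrix, g.inn_comm (u j) (u i)]
  · have h : star x ⬝ᵥ g.gramMatrix u *ᵥ x = g.inn (∑ i, x i • u i) (∑ i, x i • u i) := by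
      rw [inn_sum_smul_left]
      simp only [inn_sum_smul_right, dotProduct, Matrix.mulVec, gramMatrix, Matrix.of_apply,
        star_trivial]
      simp only [mul_comm]
    rw [h]
    refine g.posdef _ fun h0 => hx ?_
    funext i
    exact Fintype.linearIndependent_iff.1 hu x h0 i

/-- Adjoining a vector `v` multiplies the Gram determinant by at most `‖v‖²`. -/
lemma det_gramMatrix_sumElim_le {ι : Type*} [Fintype ι] [DecidableEq ι] {u : ι → Fin d → ℝ}
    (hu : LinearIndependent ℝ u) (v : Fin d → ℝ) :
    (g.gramMatrix (Sum.elim u fun _ : Unit => v)).det ≤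
      (g.gramMatrix u).det * g.inn v v := by
  have hpd := g.gramMatrix_posDef hu
  have hdet := hpd.det_pos
  have := Matrix.invertibleOfIsUnitDet _ (isUnit_iff_ne_zero.2 hdet.ne')
  have hblocks : g.gramMatrix (Sum.elim u fun _ : Unit => v) =
      Matrix.fromBlocks (g.gramMatrix u) (Matrix.of fun i _ => g.inn (u i) v)
        (Matrix.of fun _ j => g.inn v (u j)) (Matrix.of fun _ _ => g.inn v v) := by
    ext (i | i) (j | j) <;> rfl
  rw [hblocks, Matrix.det_fromBlocks₁₁]
  refine mul_le_mul_of_nonneg_left ?_ hdet.le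
  rw [Matrix.det_unique]
  have hinv := hpd.inv.posSemidef.dotProduct_mulVec_nonneg (fun i => g.inn (u i) v)
  rw [Matrix.sub_apply, Matrix.of_apply, sub_le_self_iff, Matrix.mul_assoc,
    Matrix.invOf_eq_nonsing_inv]
  convert hinv using 1
  simp [Matrix.mul_apply, dotProduct, Matrix.mulVec, g.inn_comm v]

lemma gvol_sq {s : ℕ} {u : Fin s → Fin d → ℝ} (hu : LinearIndependent ℝ u) :
    gvol g u ^ 2 = (g.gramMatrix u).det :=
  Real.sq_sqrt (g.gramMatrix_posDef hu).det_pos.le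

lemma linearIndependent_single :
    LinearIndependent ℝ fun i : Fin d => (Pi.single i 1 : Fin d → ℝ) := by
  simpa [← Pi.basisFun_apply] using (Pi.basisFun ℝ (Fin d)).linearIndependent

lemma zc_single (i : Fin d) : zc (Pi.single i 1 : Fin d → ℤ) = Pi.single i 1 := by
  funext j
  by_cases h : j = i <;> simp [zc, h]

/-- The Gram determinant of `d` linearly independent lattice vectors is at least that of the
standard basis. -/
lemma det_gramMatrix_single_le {ι : Type*} [Fintype ι] [DecidableEq ι]
    (hι : Fintype.card ι = d) {u : ι → Fin d → ℤ} (hu : LinearIndependent ℝ fun j => zc (u j)) :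
    (g.gramMatrix fun i : Fin d => Pi.single i 1).det ≤ (g.gramMatrix fun j => zc (u j)).det := by
  classical
  let e : Fin d ≃ ι := (Fintype.equivFinOfCardEq hι).symm
  let U : Matrix (Fin d) (Fin d) ℤ := Matrix.of fun i => u (e i)
  let V : Matrix (Fin d) (Fin d) ℝ := U.map (Int.cast : ℤ → ℝ)
  set S := g.gramMatrix fun i : Fin d => (Pi.single i 1 : Fin d → ℝ) with hS
  have hrow : ∀ j, zc (u (e j)) = ∑ i, V j i • (Pi.single i 1 : Fin d → ℝ) := fun j => by
    rw [← pi_eq_sum_univ' ]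
    rfl
  have hgram : (g.gramMatrix fun j => zc (u j)).submatrix e e = V * S * Vᵀ := by
    ext i j
    simp only [Matrix.submatrix_apply, gramMatrix, Matrix.of_apply, hrow, inn_sum_smul_left,
      inn_sum_smul_right, Matrix.mul_apply, Matrix.transpose_apply, hS, Finset.sum_mul,
      Finset.mul_sum]
    refine Finset.sum_congr rfl fun a _ => Finset.sum_congr rfl fun b _ => by ring
  have hV : IsUnit V := by
    rw [← Matrix.linearIndependent_rows_iff_isUnit]
    exact hu.comp e e.injective
  have hVdet : 1 ≤ V.det ^ 2 := by
    have h : V.det = (U.det : ℝ) := (Int.cast_det U).symm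
    rw [Matrix.isUnit_iff_isUnit_det, isUnit_iff_ne_zero, h] at hV
    rw [h, one_le_sq_iff_one_le_abs]
    exact_mod_cast Int.one_le_abs (by exact_mod_cast hV)
  have hSpos : 0 < S.det := (g.gramMatrix_posDef linearIndependent_single).det_pos
  rw [← Matrix.det_submatrix_equiv_self e, hgram, Matrix.det_mul, Matrix.det_mul,
    Matrix.det_transpose]
  nlinarith

lemma exists_pos_le_det_gramMatrix :
    ∃ c > 0, ∀ (s : ℕ) (u : Fin s → Fin d → ℤ), (LinearIndependent ℝ fun j => zc (u j)) →
      c ≤ (g.gramMatrix fun j => zc (u j)).det := by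
  classical
  set S := g.gramMatrix fun i : Fin d => (Pi.single i 1 : Fin d → ℝ) with hS
  have hSpos : 0 < S.det := (g.gramMatrix_posDef linearIndependent_single).det_pos
  let R : ℝ := 1 + ∑ i : Fin d, g.inn (Pi.single i 1) (Pi.single i 1)
  have hR : 1 ≤ R := le_add_of_nonneg_right (Finset.sum_nonneg fun i _ => g.inn_self_nonneg _)
  have hRi : ∀ i : Fin d, g.inn (Pi.single i 1) (Pi.single i 1) ≤ R := fun i => by
    have := Finset.single_le_sum (f := fun i : Fin d => g.inn (Pi.single i 1) (Pi.single i 1))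
      (fun i _ => g.inn_self_nonneg _) (Finset.mem_univ i)
    simp only [R]
    linarith
  have key : ∀ (n : ℕ) (ι : Type) [Fintype ι] [DecidableEq ι] (u : ι → Fin d → ℤ),
      Fintype.card ι + n = d → (LinearIndependent ℝ fun j => zc (u j)) →
      S.det ≤ (g.gramMatrix fun j => zc (u j)).det * R ^ n := by
    intro n
    induction n with
    | zero =>
      intro ι _ _ u hcard hu
      simpa using g.det_gramMatrix_single_le hcard hu
    | succ n ih =>
      intro ι _ _ u hcard hu
      obtain ⟨i, hi⟩ : ∃ i : Fin d, (Pi.single i 1 : Fin d → ℝ) ∉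
          Submodule.span ℝ (Set.range fun j => zc (u j)) := by
        by_contra! h
        have htop : (⊤ : Submodule ℝ (Fin d → ℝ)) ≤
            Submodule.span ℝ (Set.range fun j => zc (u j)) := by
          rw [← (Pi.basisFun ℝ (Fin d)).span_eq, Submodule.span_le]
          rintro _ ⟨i, rfl⟩
          simpa using h i
        have h1 := finrank_span_eq_card hu
        rw [top_le_iff.1 htop, finrank_top] at h1
        simp at h1
        omega
      let u' : ι ⊕ Unit → Fin d → ℤ := Sum.elim u fun _ => Pi.single i 1
      have hu' : (fun j => zc (u' j)) =
          Sum.elim (fun j => zc (u j)) fun _ : Unit => (Pi.single i 1 : Fin d → ℝ) := by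
        funext j
        rcases j with j | j
        · rfl
        · exact zc_single i
      have hli : LinearIndependent ℝ fun j => zc (u' j) := by
        rw [hu']
        refine hu.sum_type (LinearIndependent.of_subsingleton () ?_) ?_
        · simp
        · rw [Set.range_const]
          exact (Submodule.disjoint_span_singleton_of_notMem hi)
      have h1 := ih (ι ⊕ Unit) u' (by simp; omega) hli
      have h2 := g.det_gramMatrix_sumElim_le hu (Pi.single i 1)
      rw [← hu'] at h2
      have hpos := (g.gramMatrix_posDef hu).det_pos
      calc S.det ≤ _ := h1
        _ ≤ ((g.gramMatrix fun j => zc (u j)).det * R) * R ^ n := by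
          refine mul_le_mul_of_nonneg_right (h2.trans ?_) (by positivity)
          exact mul_le_mul_of_nonneg_left (hRi i) hpos.le
        _ = _ := by ring
  refine ⟨S.det / R ^ d, by positivity, fun s u hu => ?_⟩
  have hs : s ≤ d := by simpa using hu.fintype_card_le_finrank
  have h := key (d - s) (Fin s) u (by simp; omega) hu
  have hpos := (g.gramMatrix_posDef hu).det_pos
  rw [div_le_iff₀ (by positivity)]
  exact h.trans (mul_le_mul_of_nonneg_left (pow_le_pow_right₀ hR (by omega)) hpos.le)

lemma frakC_le_gvol {s : ℕ} (hs : 1 ≤ s) {u : Fin s → Fin d → ℤ}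
    (hu : LinearIndependent ℝ fun j => zc (u j)) : frakC g ≤ gvol g fun j => zc (u j) := by
  refine csInf_le ⟨0, ?_⟩ ⟨s, u, hs, by simpa using hu.fintype_card_le_finrank, hu, rfl⟩
  rintro _ ⟨s, u, -, -, -, rfl⟩
  exact Real.sqrt_nonneg _

lemma frakC_pos (hd : 1 ≤ d) : 0 < frakC g := by
  obtain ⟨c, hc, h⟩ := g.exists_pos_le_det_gramMatrix
  refine (Real.sqrt_pos.2 hc).trans_le (le_csInf ?_ ?_)
  · refine ⟨_, d, fun i => Pi.single i 1, hd, le_rfl, ?_, rfl⟩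
    simpa only [zc_single] using linearIndependent_single
  · rintro _ ⟨s, u, -, -, hu, rfl⟩
    exact Real.sqrt_le_sqrt (h s u hu)

lemma frakC_sq_le_det {s : ℕ} (hd : 1 ≤ d) (hs : 1 ≤ s) {u : Fin s → Fin d → ℤ}
    (hu : LinearIndependent ℝ fun j => zc (u j)) :
    frakC g ^ 2 ≤ (g.gramMatrix fun j => zc (u j)).det := by
  rw [← g.gvol_sq hu]
  exact pow_le_pow_left₀ (g.frakC_pos hd).le (g.frakC_le_gvol hs hu) 2

lemma frakC_le_nrm {k : Fin d → ℤ} (hk : zc k ≠ 0) : frakC g ≤ g.nrm (zc k) := by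
  have hu : LinearIndependent ℝ fun _ : Fin 1 => zc k := LinearIndependent.of_subsingleton 0 hk
  simpa [gvol, nrm] using g.frakC_le_gvol le_rfl (u := fun _ => k) hu

lemma abs_adjugate_gramMatrix_le {s : ℕ} {u : Fin s → Fin d → ℝ} {K : ℝ}
    (hu : ∀ j, g.nrm (u j) ≤ K) (i j : Fin s) :
    |(g.gramMatrix u).adjugate i j| ≤ s.factorial * (K ^ 2) ^ (s - 1) := by
  rw [Matrix.adjugate_apply, Matrix.det_apply]
  refine (Finset.abs_sum_le_sum_abs _ _).trans ?_
  have hterm : ∀ σ : Equiv.Perm (Fin s),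
      |Equiv.Perm.sign σ • ∏ l, (g.gramMatrix u).updateRow j (Pi.single i 1) (σ l) l| ≤
        (K ^ 2) ^ (s - 1) := by
    intro σ
    rw [Units.smul_def, zsmul_eq_mul, abs_mul, ← Int.cast_abs,
      Int.isUnit_iff_abs_eq.1 (Units.isUnit _), Int.cast_one, one_mul, Finset.abs_prod]
    calc _ ≤ ∏ l : Fin s, (if σ l = j then 1 else K ^ 2) := by
          refine Finset.prod_le_prod (fun _ _ => abs_nonneg _) fun l _ => ?_
          split_ifs with h
          · rw [h, Matrix.updateRow_self, Pi.single_apply]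
            split_ifs <;> simp
          · rw [Matrix.updateRow_ne h]
            refine (g.abs_inn_le _ _).trans ?_
            rw [sq]
            exact mul_le_mul (hu _) (hu _) (g.nrm_nonneg _) ((g.nrm_nonneg _).trans (hu l))
      _ = (K ^ 2) ^ (s - 1) := by
          rw [Equiv.prod_comp σ fun l => if l = j then (1 : ℝ) else K ^ 2, Finset.prod_ite]
          simp [Finset.filter_ne', Finset.card_erase_of_mem]
  calc _ ≤ ∑ _σ : Equiv.Perm (Fin s), (K ^ 2) ^ (s - 1) := Finset.sum_le_sum fun σ _ => hterm σ
    _ = _ := by simp [Fintype.card_perm]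

/-- Quantitative orthogonal projection: if `w` has inner products at most `α` with the linearly
independent vectors `u j` of norm at most `K`, its projection onto their span is small. -/
lemma exists_projection {s : ℕ} {u : Fin s → Fin d → ℝ} {w : Fin d → ℝ} {K α F : ℝ}
    (hK : 0 ≤ K) (hα : 0 ≤ α) (hF : 0 < F)
    (hdet : F ^ 2 ≤ (g.gramMatrix u).det) (hu : ∀ j, g.nrm (u j) ≤ K)
    (hw : ∀ j, |g.inn w (u j)| ≤ α) :
    ∃ p ∈ Submodule.span ℝ (Set.range u), (∀ j, g.inn (w - p) (u j) = 0) ∧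
      g.nrm p ≤ s * s.factorial * K ^ (s - 1) * α / F := by
  set G := g.gramMatrix u with hG
  have hdpos : 0 < G.det := (pow_pos hF 2).trans_le hdet
  set a : Fin s → ℝ := fun j => g.inn w (u j) with ha
  let c : Fin s → ℝ := G⁻¹ *ᵥ a
  let p := ∑ i, c i • u i
  have hGc : G *ᵥ c = a := by
    simp only [c, Matrix.mulVec_mulVec]
    rw [Matrix.mul_nonsing_inv _ (isUnit_iff_ne_zero.2 hdpos.ne'), Matrix.one_mulVec]
  have hp : ∀ j, g.inn p (u j) = a j := fun j => by
    rw [← hGc, inn_sum_smul_left]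
    simp [Matrix.mulVec, dotProduct, hG, gramMatrix, g.inn_comm (u j), mul_comm]
  have hpp : g.inn p p = G.det⁻¹ * ∑ i, ∑ j, G.adjugate i j * a j * a i := by
    have h1 : g.inn p p = ∑ i, c i * a i := by
      conv_lhs => rw [show g.inn p p = g.inn p (∑ i, c i • u i) from rfl]
      rw [inn_sum_smul_right]
      simp only [hp]
    rw [h1, Finset.mul_sum]
    refine Finset.sum_congr rfl fun i _ => ?_
    simp only [c, Matrix.inv_def, Matrix.mulVec, dotProduct, Matrix.smul_apply, smul_eq_mul,
      Ring.inverse_eq_inv', Finset.sum_mul, Finset.mul_sum]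
    refine Finset.sum_congr rfl fun j _ => by ring
  refine ⟨p, ?_, fun j => ?_, ?_⟩
  · exact Submodule.sum_mem _ fun i _ =>
      Submodule.smul_mem _ _ (Submodule.subset_span ⟨i, rfl⟩)
  · rw [inn_sub_left, hp, ha, sub_self]
  · refine le_of_sq_le_sq ?_ (by positivity)
    have hsum : ∑ i, ∑ j, G.adjugate i j * a j * a i ≤
        s ^ 2 * (s.factorial * (K ^ 2) ^ (s - 1) * α * α) := by
      calc _ ≤ ∑ _i : Fin s, ∑ _j : Fin s, (s.factorial * (K ^ 2) ^ (s - 1) * α * α : ℝ) := by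
            refine Finset.sum_le_sum fun i _ => Finset.sum_le_sum fun j _ => ?_
            refine (le_abs_self _).trans ?_
            rw [abs_mul, abs_mul]
            gcongr
            · exact g.abs_adjugate_gramMatrix_le hu i j
            · exact hw j
            · exact hw i
        _ = _ := by simp; ring
    have hfac : (1 : ℝ) ≤ s.factorial := by
      exact_mod_cast Nat.one_le_iff_ne_zero.2 s.factorial_ne_zero
    rw [nrm_sq, hpp]
    calc _ ≤ G.det⁻¹ * (s ^ 2 * (s.factorial * (K ^ 2) ^ (s - 1) * α * α)) :=
          mul_le_mul_of_nonneg_left hsum (inv_nonneg.2 hdpos.le)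
      _ ≤ (F ^ 2)⁻¹ * (s ^ 2 * (s.factorial * s.factorial * (K ^ 2) ^ (s - 1) * α * α)) := by
          gcongr
          exact le_mul_of_one_le_right (by positivity) hfac
      _ = _ := by
          rw [← pow_mul, mul_comm 2, pow_mul]
          field_simp

end PDForm

section Lattice

variable {d : ℕ}

/-- The cast of lattice vectors as a `ℤ`-linear map. -/
def zcLinearMap (d : ℕ) : (Fin d → ℤ) →ₗ[ℤ] (Fin d → ℝ) where
  toFun := zc
  map_add' x y := by funext i; simp [zc]
  map_smul' c x := by funext i; simp [zc]

lemma zc_injective : Function.Injective (zc (d := d)) := fun x y h => by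
  funext i
  have := congrFun h i
  simpa [zc] using this

lemma finrank_span_zc (M : Submodule ℤ (Fin d → ℤ)) :
    Module.finrank ℝ (Submodule.span ℝ (zc '' (M : Set (Fin d → ℤ)))) = zrank M := by
  have hspan : Submodule.span ℤ (zc '' (M : Set (Fin d → ℤ))) = M.map (zcLinearMap d) := by
    have h : zc '' (M : Set (Fin d → ℤ)) = M.map (zcLinearMap d) := rfl
    rw [h, Submodule.span_eq]
  have hle : Submodule.span ℤ (zc '' (M : Set (Fin d → ℤ))) ≤
      Submodule.span ℤ (Set.range (Pi.basisFun ℝ (Fin d))) := by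
    rw [Submodule.span_le]
    rintro _ ⟨k, -, rfl⟩
    have : zc k = ∑ i, k i • Pi.basisFun ℝ (Fin d) i := by
      funext j
      simp [zc, Finset.sum_apply, Pi.single_apply]
    rw [this]
    exact Submodule.sum_mem _ fun i _ => Submodule.smul_mem _ _ (Submodule.subset_span ⟨i, rfl⟩)
  have hdisc : DiscreteTopology (Submodule.span ℤ (zc '' (M : Set (Fin d → ℤ)))) :=
    DiscreteTopology.of_subset
      (s := (Submodule.span ℤ (Set.range (Pi.basisFun ℝ (Fin d))) : Set (Fin d → ℝ)))
      (inferInstanceAs (DiscreteTopology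
        (Submodule.span ℤ (Set.range (Pi.basisFun ℝ (Fin d)))))) hle
  have h := Real.finrank_eq_int_finrank_of_discrete hdisc
  rw [Set.finrank, Set.finrank, hspan] at h
  rw [h, zrank]
  exact (M.equivMapOfInjective (zcLinearMap d) zc_injective).finrank_eq.symm

lemma span_range_zc_eq {s : ℕ} {M : Submodule ℤ (Fin d → ℤ)} (hM : zrank M = s)
    {k : Fin s → Fin d → ℤ} (hk : ∀ j, k j ∈ M) (hli : LinearIndependent ℝ fun j => zc (k j)) :
    Submodule.span ℝ (Set.range fun j => zc (k j)) =
      Submodule.span ℝ (zc '' (M : Set (Fin d → ℤ))) := by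
  refine Submodule.eq_of_le_of_finrank_eq (Submodule.span_mono ?_) ?_
  · rintro _ ⟨j, rfl⟩
    exact ⟨k j, hk j, rfl⟩
  · rw [finrank_span_zc, hM, finrank_span_eq_card hli, Fintype.card_fin]

/-- Linearly independent lattice vectors lie in a saturated submodule of the right rank. -/
lemma exists_isSat_of_linearIndependent {n : ℕ} {k : Fin n → Fin d → ℤ}
    (hli : LinearIndependent ℝ fun j => zc (k j)) :
    ∃ M : Submodule ℤ (Fin d → ℤ), IsSat M ∧ zrank M = n ∧ ∀ j, k j ∈ M := by
  let V := Submodule.span ℝ (Set.range fun j => zc (k j))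
  let M : Submodule ℤ (Fin d → ℤ) := (V.restrictScalars ℤ).comap (zcLinearMap d)
  have hmem : ∀ j, k j ∈ M := fun j => Submodule.subset_span ⟨j, rfl⟩
  have hV : Submodule.span ℝ (zc '' (M : Set (Fin d → ℤ))) = V := by
    refine le_antisymm (Submodule.span_le.2 ?_) (Submodule.span_mono ?_)
    · rintro _ ⟨m, hm, rfl⟩
      exact hm
    · rintro _ ⟨j, rfl⟩
      exact ⟨k j, hmem j, rfl⟩
  refine ⟨M, fun m hm => ?_, ?_, hmem⟩
  · rw [hV] at hm
    exact hm
  · rw [← finrank_span_zc, hV, finrank_span_eq_card hli, Fintype.card_fin]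

lemma exists_notMem_of_not_le {s : ℕ} {M M' : Submodule ℤ (Fin d → ℤ)} (hM : IsSat M)
    (hM' : zrank M' = s) (hle : ¬ M' ≤ M) {k : Fin s → Fin d → ℤ} (hk : ∀ j, k j ∈ M')
    (hli : LinearIndependent ℝ fun j => zc (k j)) : ∃ j, k j ∉ M := by
  by_contra! h
  refine hle fun m hm => hM m ?_
  have h1 : zc m ∈ Submodule.span ℝ (Set.range fun j => zc (k j)) := by
    rw [span_range_zc_eq hM' hk hli]
    exact Submodule.subset_span ⟨m, hm, rfl⟩
  refine Submodule.span_mono ?_ h1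
  rintro _ ⟨j, rfl⟩
  exact ⟨k j, h j, rfl⟩

lemma xik_eq_add (κ : Fin d → ℝ) (ξ k : Fin d → ℤ) :
    xik κ ξ k = xik κ ξ 0 + (2⁻¹ : ℝ) • zc k := by
  funext i
  simp [xik, zc]
  ring

lemma xik_add_zero (κ : Fin d → ℝ) (ξ m : Fin d → ℤ) :
    xik κ (ξ + m) 0 = xik κ ξ 0 + zc m := by
  funext i
  simp [xik, zc]
  ring

end Lattice

section Absorption

lemma mul_rpow_le_mul_rpow {L X θ : ℝ} (hL : 1 ≤ L) (hX : 0 ≤ X) (hθ : θ ≤ 1) :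
    (L * X) ^ θ ≤ L * X ^ θ := by
  rw [Real.mul_rpow (by linarith) hX]
  refine mul_le_mul_of_nonneg_right ?_ (by positivity)
  simpa using Real.rpow_le_rpow_of_exponent_le hL hθ

/-- A sublinear power can be absorbed into the left-hand side. -/
lemma exists_le_mul_of_le_add_rpow {a θ : ℝ} (ha : 0 < a) (hθ : θ < 1) :
    ∃ L : ℝ, 1 ≤ L ∧ ∀ X Y : ℝ, 1 ≤ X → 1 ≤ Y → X ≤ a * Y + a * X ^ θ → X ≤ L * Y := by
  refine ⟨max 1 (max (2 * a) ((2 * a) ^ (1 - θ)⁻¹)), le_max_left _ _, fun X Y hX hY h => ?_⟩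
  by_cases hc : a * X ^ θ ≤ X / 2
  · have h1 : X ≤ 2 * a * Y := by linarith
    refine h1.trans (mul_le_mul_of_nonneg_right ?_ (by linarith))
    exact (le_max_left _ _).trans (le_max_right _ _)
  · push Not at hc
    have hX0 : 0 < X := by linarith
    have h1 : X ^ (1 - θ) ≤ 2 * a := by
      rw [Real.rpow_sub hX0, Real.rpow_one, div_le_iff₀ (by positivity)]
      linarith
    have h2 : X ≤ (2 * a) ^ (1 - θ)⁻¹ := by
      rw [Real.le_rpow_inv_iff_of_pos hX0.le (by linarith) (by linarith)]
      exact h1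
    have h3 : X ≤ max 1 (max (2 * a) ((2 * a) ^ (1 - θ)⁻¹)) :=
      h2.trans ((le_max_right _ _).trans (le_max_right _ _))
    refine h3.trans ?_
    exact le_mul_of_one_le_right (le_trans zero_le_one (le_max_left _ _)) hY

/-- Comparison of the brackets at the points occurring in the separation of resonances. -/
lemma exists_bracket_comparison {A ε θ : ℝ} (hA : 0 < A) (hε : ε < 1) (hθ : θ < 1)
    (hθ0 : 0 ≤ θ) :
    ∃ Λ : ℝ, 1 ≤ Λ ∧ ∀ X Y V T W : ℝ, 1 ≤ X → 1 ≤ Y → 1 ≤ V → 1 ≤ T → 1 ≤ W →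
      V ≤ Y + V ^ ε → T ≤ Y + T ^ ε → W ≤ Y + T ^ ε + W ^ ε → Y ≤ 4 * X + A * V ^ θ →
      V ≤ Λ * X ∧ T ≤ Λ * X ∧ W ≤ Λ * X := by
  obtain ⟨L₁, hL₁, h₁⟩ := exists_le_mul_of_le_add_rpow one_pos hε
  obtain ⟨L₂, hL₂, h₂⟩ := exists_le_mul_of_le_add_rpow (a := 1 + L₁) (by linarith) hε
  obtain ⟨L₃, hL₃, h₃⟩ := exists_le_mul_of_le_add_rpow (a := 4 + A * L₁) (by positivity) hθ
  refine ⟨max L₁ L₂ * L₃, one_le_mul_of_one_le_of_one_le (hL₁.trans (le_max_left _ _)) hL₃,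
    fun X Y V T W hX hY hV hT hW eV eT eW eY => ?_⟩
  have hVY : V ≤ L₁ * Y := h₁ V Y hV hY (by simpa using eV)
  have hTY : T ≤ L₁ * Y := h₁ T Y hT hY (by simpa using eT)
  have hTε : T ^ ε ≤ T := by simpa using Real.rpow_le_rpow_of_exponent_le hT hε.le
  have hWY : W ≤ L₂ * Y := by
    refine h₂ W Y hW hY ?_
    have : 0 ≤ L₁ * W ^ ε := by positivity
    linarith
  have hYX : Y ≤ L₃ * X := by
    refine h₃ Y X hY hX ?_
    have e1 : V ^ θ ≤ L₁ * Y ^ θ :=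
      (Real.rpow_le_rpow (by linarith) hVY hθ0).trans
        (mul_rpow_le_mul_rpow hL₁ (by linarith) hθ.le)
    have e2 := mul_le_mul_of_nonneg_left e1 hA.le
    have e3 : 0 ≤ A * L₁ * X := by positivity
    have e4 : 0 ≤ Y ^ θ := by positivity
    linarith
  have conclude : ∀ {L U : ℝ}, 1 ≤ L → L ≤ max L₁ L₂ → U ≤ L * Y → U ≤ max L₁ L₂ * L₃ * X := by
    intro L U hL hLm hU
    calc U ≤ L * Y := hU
      _ ≤ max L₁ L₂ * (L₃ * X) := by gcongr
      _ = _ := by ring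
  exact ⟨conclude hL₁ (le_max_left _ _) hVY, conclude hL₁ (le_max_left _ _) hTY,
    conclude hL₂ (le_max_right _ _) hWY⟩

/-- Final estimate: the resonance condition at one point transfers to the other one. -/
lemma resonance_transfer {A C D Λ ε τ θ δ' δ'' X V T W N I : ℝ} (hA : 0 ≤ A) (hC : 0 ≤ C)
    (hD : 1 ≤ D) (hΛ : 1 ≤ Λ) (hε : 0 ≤ ε) (hτ : 0 ≤ τ) (hεθ : ε ≤ θ) (hθ : θ ≤ 1)
    (hδ0 : 0 ≤ δ') (hδ1 : δ' ≤ 1) (hδ : δ' ≤ δ'') (hexp : θ + ε * (1 + τ) ≤ δ'')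
    (hX : 1 ≤ X) (hV : 1 ≤ V) (hT : 1 ≤ T) (hW : 1 ≤ W)
    (hVX : V ≤ Λ * X) (hTX : T ≤ Λ * X) (hWX : W ≤ Λ * X) (hN : 0 < N) (hND : N ≤ D * W ^ ε)
    (hI : I ≤ C * W ^ δ' * N ^ (-τ) + (A * X ^ θ + A * V ^ θ + T ^ ε + X ^ ε + W ^ ε) * N) :
    N ≤ D * Λ * X ^ ε ∧
      I ≤ (C * Λ + (A + A * Λ + Λ + 1 + Λ) * (D * Λ) ^ (1 + τ)) * X ^ δ'' * N ^ (-τ) := by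
  have hX0 : 0 ≤ X := by linarith
  have hpow : ∀ {U e : ℝ}, 1 ≤ U → U ≤ Λ * X → 0 ≤ e → e ≤ 1 → U ^ e ≤ Λ * X ^ e :=
    fun hU hUX he0 he1 => (Real.rpow_le_rpow (by linarith) hUX he0).trans
      (mul_rpow_le_mul_rpow hΛ hX0 he1)
  have hε1 : ε ≤ 1 := hεθ.trans hθ
  have hNX : N ≤ D * Λ * X ^ ε := by
    rw [mul_assoc]
    exact hND.trans (mul_le_mul_of_nonneg_left (hpow hW hWX hε hε1) (by linarith))
  refine ⟨hNX, hI.trans ?_⟩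
  have hXθ : X ^ ε ≤ X ^ θ := Real.rpow_le_rpow_of_exponent_le hX hεθ
  have hXδ : X ^ δ' ≤ X ^ δ'' := Real.rpow_le_rpow_of_exponent_le hX hδ
  have hNτ : N = N ^ (1 + τ) * N ^ (-τ) := by
    rw [← Real.rpow_add hN]
    simp
  have hNpow : N ^ (1 + τ) ≤ (D * Λ) ^ (1 + τ) * X ^ (ε * (1 + τ)) := by
    refine (Real.rpow_le_rpow hN.le hNX (by linarith)).trans_eq ?_
    rw [Real.mul_rpow (by positivity) (by positivity), ← Real.rpow_mul hX0]
  have hsum : A * X ^ θ + A * V ^ θ + T ^ ε + X ^ ε + W ^ ε ≤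
      (A + A * Λ + Λ + 1 + Λ) * X ^ θ := by
    have e1 := mul_le_mul_of_nonneg_left (hpow hV hVX (hε.trans hεθ) hθ) hA
    have e2 := hpow hT hTX hε hε1
    have e3 := hpow hW hWX hε hε1
    have e4 := mul_le_mul_of_nonneg_left hXθ (zero_le_one.trans hΛ)
    linarith
  have hprod : X ^ θ * X ^ (ε * (1 + τ)) ≤ X ^ δ'' := by
    rw [← Real.rpow_add (by linarith)]
    exact Real.rpow_le_rpow_of_exponent_le hX hexp
  have hfirst : C * W ^ δ' * N ^ (-τ) ≤ C * Λ * X ^ δ'' * N ^ (-τ) := by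
    rw [mul_assoc C Λ]
    gcongr
    exact (hpow hW hWX hδ0 hδ1).trans (mul_le_mul_of_nonneg_left hXδ (by linarith))
  have hsecond : (A * X ^ θ + A * V ^ θ + T ^ ε + X ^ ε + W ^ ε) * N ≤
      (A + A * Λ + Λ + 1 + Λ) * (D * Λ) ^ (1 + τ) * X ^ δ'' * N ^ (-τ) := by
    calc _ ≤ (A + A * Λ + Λ + 1 + Λ) * X ^ θ *
          ((D * Λ) ^ (1 + τ) * X ^ (ε * (1 + τ)) * N ^ (-τ)) := by
          conv_lhs => rw [hNτ]
          gcongr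
      _ = (A + A * Λ + Λ + 1 + Λ) * (D * Λ) ^ (1 + τ) * (X ^ θ * X ^ (ε * (1 + τ))) *
          N ^ (-τ) := by ring
      _ ≤ _ := by gcongr
  linarith

end Absorption

namespace ZoneData

variable {d : ℕ} (Z : ZoneData d)

/-- A point of the zone of a tuple generating `M` has small projection onto the span of `M`. -/
lemma exists_small_projection {s : ℕ} {M : Submodule ℤ (Fin d → ℤ)} {C D : ℝ} (hd : 1 ≤ d)
    (hε : 0 ≤ Z.ε) (hτ : 0 ≤ Z.τ) (hεδ : Z.ε ≤ Z.δ) (hC : 0 ≤ C) (hD : 0 ≤ D)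
    (hCs : ∀ j < s, Z.Cs j ≤ C) (hDs : ∀ j < s, Z.Ds j ≤ D) (hD0 : Z.Ds 0 = 1)
    (hM : zrank M = s) {ξ : Fin d → ℤ} (hs : 0 < s) {k : Fin s → Fin d → ℤ}
    (hkM : ∀ j, k j ∈ M) (hli : LinearIndependent ℝ fun j => zc (k j))
    (hk : ∀ j : Fin s,
      |Z.g.inn (xik Z.κ ξ (k ⟨0, hs⟩)) (zc (k j))| ≤
        Z.Cs j * (Z.g.jap (xik Z.κ ξ (k ⟨0, hs⟩))) ^ (Z.δs j) * (Z.g.nrm (zc (k j))) ^ (-Z.τ) ∧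
      Z.g.nrm (zc (k j)) ≤ Z.Ds j * (Z.g.jap (xik Z.κ ξ (k ⟨0, hs⟩))) ^ Z.ε) :
    ∃ p ∈ Submodule.span ℝ (zc '' (M : Set (Fin d → ℤ))),
      (∀ y ∈ Submodule.span ℝ (zc '' (M : Set (Fin d → ℤ))),
        Z.g.inn (xik Z.κ ξ 0 - p) y = 0) ∧
      Z.g.nrm p ≤ (s * s.factorial * D ^ (s - 1) * (C * frakC Z.g ^ (-Z.τ)) / frakC Z.g + 1) *
        Z.g.jap (xik Z.κ ξ (k ⟨0, hs⟩)) ^ (Z.δs (s - 1) + (s - 1 : ℕ) * Z.ε) := by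
  set X := Z.g.jap (xik Z.κ ξ (k ⟨0, hs⟩)) with hXdef
  have hX : 1 ≤ X := Z.g.one_le_jap _
  have hX0 : 0 < X := by linarith
  set F := frakC Z.g with hFdef
  have hF : 0 < F := Z.g.frakC_pos hd
  have hstep : 0 ≤ ((d : ℝ) + Z.τ + 1) * Z.ε := by positivity
  have hα : ∀ j, |Z.g.inn (xik Z.κ ξ (k ⟨0, hs⟩)) (zc (k j))| ≤
      C * X ^ Z.δs (s - 1) * F ^ (-Z.τ) := fun j => by
    refine (hk j).1.trans ?_
    have hjs : ((j : ℕ) : ℝ) ≤ ((s - 1 : ℕ) : ℝ) := by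
      have := j.2
      exact_mod_cast (by omega : (j : ℕ) ≤ s - 1)
    have h1 : X ^ Z.δs j ≤ X ^ Z.δs (s - 1) := by
      refine Real.rpow_le_rpow_of_exponent_le hX ?_
      simp only [δs]
      linarith [mul_le_mul_of_nonneg_right hjs hstep]
    have h2 : Z.g.nrm (zc (k j)) ^ (-Z.τ) ≤ F ^ (-Z.τ) :=
      Real.rpow_le_rpow_of_nonpos hF (Z.g.frakC_le_nrm (hli.ne_zero j)) (by linarith)
    have := hCs j j.2
    have h3 : 0 ≤ Z.g.nrm (zc (k j)) ^ (-Z.τ) := Real.rpow_nonneg (Z.g.nrm_nonneg _) _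
    gcongr
  have hK : ∀ j, Z.g.nrm (zc (k j)) ≤ D * X ^ Z.ε := fun j =>
    (hk j).2.trans (mul_le_mul_of_nonneg_right (hDs j j.2) (by positivity))
  obtain ⟨p, hpmem, horth, hp⟩ := Z.g.exists_projection (by positivity) (by positivity) hF
    (Z.g.frakC_sq_le_det hd hs hli) hK hα
  have hspan := span_range_zc_eq hM hkM hli
  have hk1 : (2⁻¹ : ℝ) • zc (k ⟨0, hs⟩) ∈ Submodule.span ℝ (zc '' (M : Set (Fin d → ℤ))) :=
    Submodule.smul_mem _ _ (Submodule.subset_span ⟨_, hkM _, rfl⟩)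
  refine ⟨p - (2⁻¹ : ℝ) • zc (k ⟨0, hs⟩), Submodule.sub_mem _ (hspan ▸ hpmem) hk1, ?_, ?_⟩
  · intro y hy
    have heq : xik Z.κ ξ 0 - (p - (2⁻¹ : ℝ) • zc (k ⟨0, hs⟩)) = xik Z.κ ξ (k ⟨0, hs⟩) - p := by
      rw [xik_eq_add Z.κ ξ (k ⟨0, hs⟩)]
      abel
    rw [heq]
    rw [← hspan] at hy
    induction hy using Submodule.span_induction with
    | mem y hy =>
      obtain ⟨j, rfl⟩ := hy
      exact horth j
    | zero => simp [PDForm.inn]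
    | add x y _ _ hx hy =>
      simp only [PDForm.inn, map_add] at hx hy ⊢
      linarith
    | smul c x _ hx =>
      simp only [PDForm.inn, map_smul] at hx ⊢
      rw [hx, smul_zero]
  · have hk1n : Z.g.nrm ((2⁻¹ : ℝ) • zc (k ⟨0, hs⟩)) ≤ X ^ (Z.δs (s - 1) + (s - 1 : ℕ) * Z.ε) := by
      have h1 : Z.g.nrm (zc (k ⟨0, hs⟩)) ≤ X ^ Z.ε := by simpa [hD0] using (hk ⟨0, hs⟩).2
      have h2 : X ^ Z.ε ≤ X ^ (Z.δs (s - 1) + (s - 1 : ℕ) * Z.ε) := by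
        refine Real.rpow_le_rpow_of_exponent_le hX ?_
        have e1 : 0 ≤ ((s - 1 : ℕ) : ℝ) * (((d : ℝ) + Z.τ + 1) * Z.ε) := by positivity
        have e2 : 0 ≤ ((s - 1 : ℕ) : ℝ) * Z.ε := by positivity
        simp only [δs]
        linarith
      rw [Z.g.nrm_smul, abs_of_pos (by norm_num)]
      linarith [Z.g.nrm_nonneg (zc (k ⟨0, hs⟩))]
    have hpow : (X ^ Z.ε) ^ (s - 1) * X ^ Z.δs (s - 1) =
        X ^ (Z.δs (s - 1) + (s - 1 : ℕ) * Z.ε) := by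
      rw [← Real.rpow_natCast, ← Real.rpow_mul hX0.le, ← Real.rpow_add hX0]
      congr 1
      ring
    refine (Z.g.nrm_sub_le _ _).trans ?_
    rw [add_mul, one_mul]
    refine add_le_add (hp.trans_eq ?_) hk1n
    rw [← hpow]
    ring

end ZoneData

lemma SeqOK.le_of_le {d : ℕ} {Cs Ds : ℕ → ℝ} (h : SeqOK d Cs Ds) {i j : ℕ} (hij : i ≤ j)
    (hj : j + 1 ≤ d) : Cs i ≤ Cs j ∧ Ds i ≤ Ds j := by
  induction j, hij using Nat.le_induction with
  | base => exact ⟨le_rfl, le_rfl⟩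
  | succ j hij ih =>
    obtain ⟨h1, h2⟩ := ih (by omega)
    exact ⟨h1.trans (h.2.2.1 j hj).le, h2.trans (h.2.2.2 j hj).le⟩

namespace PDForm

variable {d : ℕ} (g : PDForm d)

lemma nrm_le_nrm_add_of_inn_eq_zero {q p : Fin d → ℝ} (h : g.inn q p = 0) :
    g.nrm q ≤ g.nrm (q + p) := by
  refine Real.sqrt_le_sqrt ?_
  have h' : g.inn p q = 0 := by rw [inn_comm, h]
  have := g.inn_self_nonneg p
  simp only [inn, map_add, LinearMap.add_apply] at *
  linarith

/-- Orthogonal decompositions with respect to `V` of two points that differ by an element of `V`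
have the same component orthogonal to `V`. -/
lemma orthogonal_part_eq {V : Submodule ℝ (Fin d → ℝ)} {x y p q : Fin d → ℝ} (hp : p ∈ V)
    (hq : q ∈ V) (hxp : ∀ v ∈ V, g.inn (x - p) v = 0) (hyq : ∀ v ∈ V, g.inn (y - q) v = 0)
    (hxy : x - y ∈ V) : x - p = y - q := by
  have hmem : (x - p) - (y - q) ∈ V := by
    have : (x - p) - (y - q) = (x - y) - (p - q) := by abel
    rw [this]
    exact V.sub_mem hxy (V.sub_mem hp hq)
  by_contra hne
  have hpos := g.posdef _ (sub_ne_zero.2 hne)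
  have hz : g.inn ((x - p) - (y - q)) ((x - p) - (y - q)) = 0 := by
    rw [inn_sub_left, hxp _ hmem, hyq _ hmem, sub_zero]
  exact hpos.ne' hz

end PDForm

/-- Separation of resonances, with constants depending on `𝔉`, `C_{s-1}` and `D_{s-1}`. -/
lemma exists_separation_constants {d s : ℕ} {δ ε τ : ℝ} (hpar : ParamsOK d δ ε τ)
    (hs1 : 1 ≤ s) (hsd : s ≤ d - 1) {F C D : ℝ} (hF : 0 < F) (hC : 1 ≤ C) (hD : 1 ≤ D) :
    ∃ Ct Dt : ℝ, 0 < Ct ∧ 0 < Dt ∧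
      ∀ (g : PDForm d) (κ : Fin d → ℝ) (E : Set (Fin d → ℤ)) (Cs Ds : ℕ → ℝ),
        SeqOK d Cs Ds → frakC g = F → Cs (s - 1) = C → Ds (s - 1) = D → Ct < Cs s → Dt < Ds s →
        ∀ (M : Submodule ℤ (Fin d → ℤ)), IsSat M → zrank M = s →
          ∀ ζ ∈ (⟨g, κ, E, δ, ε, τ, Cs, Ds⟩ : ZoneData d).EM s M, ∀ k' : Fin d → ℤ,
            g.nrm (zc k') ≤ (g.jap (xik κ ζ k')) ^ ε →
            ∀ (M' : Submodule ℤ (Fin d → ℤ)) (s' : ℕ),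
              zrank M' = s' → s' ≤ s → ¬ M' ≤ M →
              ζ + k' ∉ (⟨g, κ, E, δ, ε, τ, Cs, Ds⟩ : ZoneData d).ZM s' M' := by
  obtain ⟨hd, hδ0, hδ1, hε, hτd, hsum, hεδ⟩ := hpar
  have hdR : (1 : ℝ) ≤ d := by exact_mod_cast hd
  have hτ : 0 < τ := by linarith
  have hεleδ : ε ≤ δ := by nlinarith
  have hε1 : ε < 1 := by linarith
  let δ' : ℝ := δ + (s - 1 : ℕ) * ((d + τ + 1) * ε)
  let δ'' : ℝ := δ + s * ((d + τ + 1) * ε)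
  let θ : ℝ := δ' + (s - 1 : ℕ) * ε
  have hsR : (s : ℝ) + 1 ≤ d := by exact_mod_cast (by omega : s + 1 ≤ d)
  have hsR1 : (1 : ℝ) ≤ s := by exact_mod_cast hs1
  have hs1R : ((s - 1 : ℕ) : ℝ) = s - 1 := by push_cast [Nat.cast_sub hs1]; ring
  have hstep : 0 < (d + τ + 1) * ε := by positivity
  have hδ'' : δ'' = δ' + (d + τ + 1) * ε := by simp only [δ', δ'', hs1R]; ring
  have hδ''1 : δ'' < 1 := by
    have : (s : ℝ) * ((d + τ + 1) * ε) ≤ d * ((d + τ + 1) * ε) := by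
      gcongr
      omega
    simp only [δ'']
    linarith
  have hδδ' : δ ≤ δ' := le_add_of_nonneg_right (by positivity)
  have hδ'θ : δ' ≤ θ := le_add_of_nonneg_right (by positivity)
  have hexp : θ + ε * (1 + τ) ≤ δ'' := by
    simp only [θ, hδ'', hs1R]
    nlinarith
  have hθ1 : θ < 1 := by nlinarith
  let A : ℝ := s * s.factorial * D ^ (s - 1) * (C * F ^ (-τ)) / F + 1
  have hA : 0 < A := by positivity
  obtain ⟨Λ, hΛ, hcomp⟩ := exists_bracket_comparison hA hε1 hθ1 (by linarith)
  refine ⟨C * Λ + (A + A * Λ + Λ + 1 + Λ) * (D * Λ) ^ (1 + τ), D * Λ, by positivity,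
    by positivity, ?_⟩
  intro g κ E Cs Ds hseq hFg hCs hDs hCt hDt M hMsat hM ζ hζ k' hk' M' s' hM' hs's hnle hmem
  set Z : ZoneData d := ⟨g, κ, E, δ, ε, τ, Cs, Ds⟩ with hZ
  have hCle : ∀ j < s, Z.Cs j ≤ C := fun j hj => hCs ▸ (hseq.le_of_le (by omega) (by omega)).1
  have hDle : ∀ j < s, Z.Ds j ≤ D := fun j hj => hDs ▸ (hseq.le_of_le (by omega) (by omega)).2
  have hD0 : Z.Ds 0 = 1 := hseq.2.1
  rw [ZoneData.EM] at hζ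
  obtain ⟨⟨b, ⟨hbZ, hbnot⟩, m, hmM, hζb⟩, hζZ, -⟩ := hζ
  obtain ⟨hbE, hs, k, hkM, hkli, hk⟩ := hbZ
  obtain ⟨-, hs₂, l, hlM, hlli, hl⟩ := hζZ
  obtain ⟨-, hs', n, hnM', hnli, hn⟩ := hmem
  obtain ⟨j, hj⟩ := exists_notMem_of_not_le hMsat hM' hnle hnM' hnli
  obtain ⟨p, hp, hporth, hpn⟩ := Z.exists_small_projection hd hε.le hτ.le hεleδ (by linarith)
    (by linarith) hCle hDle hD0 hM hs hkM hkli hk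
  obtain ⟨q, hq, hqorth, hqn⟩ := Z.exists_small_projection hd hε.le hτ.le hεleδ (by linarith)
    (by linarith) hCle hDle hD0 hM hs₂ hlM hlli hl
  have hk1 : g.nrm (zc (k ⟨0, hs⟩)) ≤ g.jap (xik κ b (k ⟨0, hs⟩)) ^ ε := by
    simpa [hD0] using (hk ⟨0, hs⟩).2
  have hl1 : g.nrm (zc (l ⟨0, hs₂⟩)) ≤ g.jap (xik κ ζ (l ⟨0, hs₂⟩)) ^ ε := by
    simpa [hD0] using (hl ⟨0, hs₂⟩).2
  have hn1 : g.nrm (zc (n ⟨0, hs'⟩)) ≤ g.jap (xik κ (ζ + k') (n ⟨0, hs'⟩)) ^ ε := by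
    simpa [hD0] using (hn ⟨0, hs'⟩).2
  have hζx : xik κ ζ 0 = xik κ b 0 + zc m := by rw [hζb, xik_add_zero]
  have horth : xik κ b 0 - p = xik κ ζ 0 - q := by
    refine g.orthogonal_part_eq hp hq hporth hqorth ?_
    have : xik κ b 0 - xik κ ζ 0 = -zc m := by rw [hζx]; abel
    rw [this]
    exact Submodule.neg_mem _ (Submodule.subset_span ⟨m, hmM, rfl⟩)
  set X := g.jap (xik κ b (k ⟨0, hs⟩)) with hXdef
  set V := g.jap (xik κ ζ (l ⟨0, hs₂⟩)) with hVdef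
  set T := g.jap (xik κ ζ k') with hTdef
  set W := g.jap (xik κ (ζ + k') (n ⟨0, hs'⟩)) with hWdef
  have hX : 1 ≤ X := g.one_le_jap _
  have hV : 1 ≤ V := g.one_le_jap _
  have hT : 1 ≤ T := g.one_le_jap _
  have hW : 1 ≤ W := g.one_le_jap _
  have hhalf : ∀ v : Fin d → ℝ, g.nrm ((2⁻¹ : ℝ) • v) ≤ g.nrm v := fun v => by
    rw [g.nrm_smul, abs_of_pos (by norm_num)]
    linarith [g.nrm_nonneg v]
  have hpA : g.nrm p ≤ A * X ^ θ := by
    have h : frakC Z.g = F := hFg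
    rw [h] at hpn
    exact hpn
  have hqA : g.nrm q ≤ A * V ^ θ := by
    have h : frakC Z.g = F := hFg
    rw [h] at hqn
    exact hqn
  have hbracket : ∀ ξ v : Fin d → ℤ, g.jap (xik κ ξ v) ≤ g.jap (xik κ ξ 0) + g.nrm (zc v) :=
    fun ξ v => by
      rw [xik_eq_add κ ξ v]
      exact (g.jap_add_le _ _).trans (add_le_add_right (hhalf _) _)
  have hYX : g.jap (xik κ ζ 0) ≤ 4 * X + A * V ^ θ := by
    have h1 : xik κ ζ 0 = (xik κ b 0 - p) + q := by rw [horth]; abel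
    have h2 : g.nrm (xik κ b 0 - p) ≤ g.nrm (xik κ b 0) := by
      simpa using g.nrm_le_nrm_add_of_inn_eq_zero (hporth p hp)
    have h3 : g.nrm (xik κ b 0) ≤ g.jap (xik κ b 0) := g.nrm_le_jap _
    have h4 : g.jap (xik κ b 0) ≤ X + g.nrm (zc (k ⟨0, hs⟩)) := by
      have e : xik κ b 0 = xik κ b (k ⟨0, hs⟩) + -((2⁻¹ : ℝ) • zc (k ⟨0, hs⟩)) := by
        rw [xik_eq_add κ b (k ⟨0, hs⟩)]
        abel
      rw [e]
      refine (g.jap_add_le _ _).trans ?_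
      rw [g.nrm_neg]
      exact add_le_add_right (hhalf _) _
    have h5 : X ^ ε ≤ X := by simpa using Real.rpow_le_rpow_of_exponent_le hX hε1.le
    have h6 := g.jap_le_one_add_nrm (xik κ b 0 - p)
    rw [h1]
    linarith [g.jap_add_le (xik κ b 0 - p) q]
  have hWY : W ≤ g.jap (xik κ ζ 0) + T ^ ε + W ^ ε := by
    have h1 := hbracket (ζ + k') (n ⟨0, hs'⟩)
    rw [xik_add_zero] at h1
    linarith [g.jap_add_le (xik κ ζ 0) (zc k')]
  obtain ⟨hVX, hTX, hWX⟩ := hcomp X (g.jap (xik κ ζ 0)) V T W hX (g.one_le_jap _) hV hT hW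
    (by linarith [hbracket ζ (l ⟨0, hs₂⟩)]) (by linarith [hbracket ζ k']) hWY hYX
  have hjs : (j : ℕ) < s := j.2.trans_le hs's
  have hN : 0 < g.nrm (zc (n j)) := hF.trans_le (hFg ▸ g.frakC_le_nrm (hnli.ne_zero j))
  have hND : g.nrm (zc (n j)) ≤ D * W ^ ε :=
    (hn j).2.trans (mul_le_mul_of_nonneg_right (hDle j hjs) (by positivity))
  have hres : |g.inn (xik κ (ζ + k') (n ⟨0, hs'⟩)) (zc (n j))| ≤
      C * W ^ δ' * g.nrm (zc (n j)) ^ (-τ) := by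
    refine (hn j).1.trans ?_
    have h1 : W ^ Z.δs j ≤ W ^ δ' := by
      refine Real.rpow_le_rpow_of_exponent_le hW ?_
      have : ((j : ℕ) : ℝ) ≤ ((s - 1 : ℕ) : ℝ) := by exact_mod_cast (by omega : (j : ℕ) ≤ s - 1)
      simp only [ZoneData.δs, δ', hZ]
      gcongr
    have h2 := hCle j hjs
    have h3 : 0 ≤ g.nrm (zc (n j)) ^ (-τ) := by positivity
    show Z.Cs j * W ^ Z.δs j * _ ≤ _
    gcongr
  have hI : |g.inn (xik κ b (k ⟨0, hs⟩)) (zc (n j))| ≤ C * W ^ δ' * g.nrm (zc (n j)) ^ (-τ) +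
      (A * X ^ θ + A * V ^ θ + T ^ ε + X ^ ε + W ^ ε) * g.nrm (zc (n j)) := by
    have hdec : xik κ b (k ⟨0, hs⟩) = xik κ (ζ + k') (n ⟨0, hs'⟩) +
        ((p - q) - zc k' + (2⁻¹ : ℝ) • zc (k ⟨0, hs⟩) - (2⁻¹ : ℝ) • zc (n ⟨0, hs'⟩)) := by
      have hb : xik κ b 0 = xik κ ζ 0 - q + p := by rw [← horth]; abel
      rw [xik_eq_add κ b (k ⟨0, hs⟩), xik_eq_add κ (ζ + k') (n ⟨0, hs'⟩), xik_add_zero, hb]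
      abel
    rw [hdec, g.inn_add_left]
    refine (abs_add_le _ _).trans (add_le_add hres ((g.abs_inn_le _ _).trans ?_))
    refine mul_le_mul_of_nonneg_right ?_ hN.le
    linarith [g.nrm_sub_le (p - q - zc k' + (2⁻¹ : ℝ) • zc (k ⟨0, hs⟩))
        ((2⁻¹ : ℝ) • zc (n ⟨0, hs'⟩)),
      g.nrm_add_le (p - q - zc k') ((2⁻¹ : ℝ) • zc (k ⟨0, hs⟩)), g.nrm_sub_le (p - q) (zc k'),
      g.nrm_sub_le p q, hhalf (zc (k ⟨0, hs⟩)), hhalf (zc (n ⟨0, hs'⟩))]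
  obtain ⟨hNX, hIX⟩ := resonance_transfer hA.le (by linarith) hD hΛ hε.le hτ.le (by linarith)
    hθ1.le (by linarith) (by linarith) (by linarith) hexp hX hV hT hW hVX hTX hWX hN hND hI
  have hnotspan : zc (n j) ∉ Submodule.span ℝ (Set.range fun i => zc (k i)) := fun h => by
    rw [span_range_zc_eq hM hkM hkli] at h
    exact hj (hMsat _ h)
  let t : Fin (s + 1) → Fin d → ℤ := Fin.snoc k (n j)
  have htli : LinearIndependent ℝ fun i => zc (t i) := by
    have : (fun i => zc (t i)) = Fin.snoc (fun i => zc (k i)) (zc (n j)) := by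
      funext i
      refine Fin.lastCases ?_ (fun i => ?_) i <;> simp [t]
    rw [this]
    exact linearIndependent_finSnoc.2 ⟨hkli, hnotspan⟩
  obtain ⟨N, hNsat, hNrank, htN⟩ := exists_isSat_of_linearIndependent htli
  refine hbnot (Set.mem_iUnion₂.2 ⟨N, ⟨hNsat, hNrank⟩, hbE, Nat.succ_pos s, t, htN, htli, ?_⟩)
  have ht0 : t ⟨0, Nat.succ_pos s⟩ = k ⟨0, hs⟩ := Fin.snoc_castSucc (α := fun _ => Fin d → ℤ)
    (n j) k ⟨0, hs⟩
  rw [ht0]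
  intro i
  refine Fin.lastCases ?_ (fun i => ?_) i
  · have htl : t (Fin.last s) = n j := Fin.snoc_last (α := fun _ => Fin d → ℤ) (n j) k
    rw [htl, Fin.val_last]
    refine ⟨hIX.trans ?_, hNX.trans ?_⟩
    · have h3 : 0 ≤ g.nrm (zc (n j)) ^ (-τ) := by positivity
      show _ ≤ Cs s * X ^ δ'' * _
      gcongr
    · show _ ≤ Ds s * X ^ ε
      gcongr
  · have htc : t i.castSucc = k i := Fin.snoc_castSucc (α := fun _ => Fin d → ℤ) (n j) k i
    rw [htc]
    exact hk i

/-- separation of resonances. For every `1 ≤ s ≤ d-1` there are positive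
constants `C̃_s, D̃_s`, depending only on `𝔠, 𝔉, d, ε, τ, δ_{s-1}, C_{s-1}, D_{s-1}`, such
that if `C_s > C̃_s` and `D_s > D̃_s` then for every submodule `M` of dimension `s`, every
`ζ ∈ E⁽ˢ⁾_M` and every `k'` with `‖k'‖ ≤ ⟨ζ_{k'}⟩^ε` one has `ζ + k' ∉ Z⁽ˢ'⁾_{M'}` for
every submodule `M' ⊄ M` of dimension `1 ≤ s' ≤ s`. -/
theorem statement4 (d s : ℕ) (δ ε τ : ℝ) (hpar : ParamsOK d δ ε τ)
    (hs1 : 1 ≤ s) (hsd : s ≤ d - 1) :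
    ∃ Ctil Dtil : ℝ → ℝ → ℝ → ℝ → ℝ,
      (∀ a b c e, 0 < Ctil a b c e ∧ 0 < Dtil a b c e) ∧
      ∀ (g : PDForm d) (κ : Fin d → ℝ) (E : Set (Fin d → ℤ)) (Cs Ds : ℕ → ℝ),
        SeqOK d Cs Ds →
        Ctil (frakc g) (frakC g) (Cs (s - 1)) (Ds (s - 1)) < Cs s →
        Dtil (frakc g) (frakC g) (Cs (s - 1)) (Ds (s - 1)) < Ds s →
        let Z : ZoneData d := ⟨g, κ, E, δ, ε, τ, Cs, Ds⟩
        ∀ (M : Submodule ℤ (Fin d → ℤ)), IsSat M → zrank M = s →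
          ∀ ζ ∈ Z.EM s M, ∀ k' : Fin d → ℤ,
            g.nrm (zc k') ≤ (g.jap (xik κ ζ k')) ^ ε →
            ∀ (M' : Submodule ℤ (Fin d → ℤ)) (s' : ℕ),
              IsSat M' → zrank M' = s' → 1 ≤ s' → s' ≤ s → ¬ M' ≤ M →
              ζ + k' ∉ Z.ZM s' M' := by
  have hd : 1 ≤ d := hpar.1
  have key : ∀ _a b c e : ℝ, ∃ Ct Dt : ℝ, 0 < Ct ∧ 0 < Dt ∧ (0 < b → 1 ≤ c → 1 ≤ e →
      ∀ (g : PDForm d) (κ : Fin d → ℝ) (E : Set (Fin d → ℤ)) (Cs Ds : ℕ → ℝ),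
        SeqOK d Cs Ds → frakC g = b → Cs (s - 1) = c → Ds (s - 1) = e → Ct < Cs s → Dt < Ds s →
        ∀ (M : Submodule ℤ (Fin d → ℤ)), IsSat M → zrank M = s →
          ∀ ζ ∈ (⟨g, κ, E, δ, ε, τ, Cs, Ds⟩ : ZoneData d).EM s M, ∀ k' : Fin d → ℤ,
            g.nrm (zc k') ≤ (g.jap (xik κ ζ k')) ^ ε →
            ∀ (M' : Submodule ℤ (Fin d → ℤ)) (s' : ℕ),
              zrank M' = s' → s' ≤ s → ¬ M' ≤ M →
              ζ + k' ∉ (⟨g, κ, E, δ, ε, τ, Cs, Ds⟩ : ZoneData d).ZM s' M') := by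
    intro _ b c e
    by_cases h : 0 < b ∧ 1 ≤ c ∧ 1 ≤ e
    · obtain ⟨Ct, Dt, hCt, hDt, H⟩ :=
        exists_separation_constants hpar hs1 hsd h.1 h.2.1 h.2.2
      exact ⟨Ct, Dt, hCt, hDt, fun _ _ _ => H⟩
    · exact ⟨1, 1, one_pos, one_pos, fun hb hc he => absurd ⟨hb, hc, he⟩ h⟩
  choose Ctil Dtil hCpos hDpos H using key
  refine ⟨Ctil, Dtil, fun a b c e => ⟨hCpos a b c e, hDpos a b c e⟩, ?_⟩
  intro g κ E Cs Ds hseq hC hD Z M hMsat hM ζ hζ k' hk' M' s' _ hM' _ hs's hnle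
  have hmono := hseq.le_of_le (Nat.zero_le (s - 1)) (by omega)
  rw [hseq.1, hseq.2.1] at hmono
  exact H _ _ _ _ (g.frakC_pos hd) hmono.1 hmono.2 g κ E Cs Ds hseq rfl rfl rfl hC hD M hMsat hM
    ζ hζ k' hk' M' s' hM' hs's hnle
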